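/- Let 0 < δ < 1 and k > 0 be real numbers and let ε > 0. Then there exists N such that for every integer c ≥ N and every δ' : Fin c → ℝ with 0 < δ' i < 1 for all i and ∏ i, (1 - δ' i) ≥ 1 - δ, the fraction of indices satisfying Real.log (1 / δ' i) > k is at least 1 - ε; that is, (card {i | Real.log (1 / δ' i) > k}) / c ≥ 1 - ε. -/

import Mathlib

/-- If the factors `1 - f i` lie in `[0, 1]`, their product is at most `(1 - t) ^ m`, where `m`
counts the indices with `t ≤ f i`. -/
lemma prod_one_sub_le_pow_card_filter {ι : Type*} [Fintype ι] (f : ι → ℝ) (t : ℝ)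
    (hf : ∀ i, 0 ≤ f i ∧ f i ≤ 1) :
    ∏ i, (1 - f i) ≤ (1 - t) ^ (Finset.univ.filter fun i => t ≤ f i).card := by
  rw [← Finset.prod_filter_mul_prod_filter_not Finset.univ (fun i => t ≤ f i)]
  have h_large : ∏ i with t ≤ f i, (1 - f i) ≤
      (1 - t) ^ (Finset.univ.filter fun i => t ≤ f i).card := by
    rw [← Finset.prod_const]
    refine Finset.prod_le_prod (fun i _ => sub_nonneg.2 (hf i).2) fun i hi => ?_
    linarith [(Finset.mem_filter.1 hi).2]
  have h_small : ∏ i with ¬ t ≤ f i, (1 - f i) ≤ 1 :=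
    Finset.prod_le_one (fun i _ => sub_nonneg.2 (hf i).2) fun i _ => by linarith [(hf i).1]
  exact (mul_le_of_le_one_right
    (Finset.prod_nonneg fun i _ => sub_nonneg.2 (hf i).2) h_small).trans h_large

/-- Worst-case convergence: for a fixed total failure budget `δ`, as the number
of strata grows, the fraction of strata with `log (1 / δ' i) > k` is at least
`1 - ε` for any `ε > 0`. -/
theorem fraction_of_large_log_terms_tendsto_one
    (δ k ε : ℝ) (hδ0 : 0 < δ) (hδ1 : δ < 1) (hk : 0 < k) (hε : 0 < ε) :
    ∃ N : ℕ, ∀ c : ℕ, N ≤ c → ∀ δ' : Fin c → ℝ,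
      (∀ i, 0 < δ' i ∧ δ' i < 1) → 1 - δ ≤ ∏ i, (1 - δ' i) →
      1 - ε ≤ (({i : Fin c | k < Real.log (1 / δ' i)} : Set (Fin c)).ncard : ℝ) / c := by
  have hq0 : 0 ≤ 1 - Real.exp (-k) := by
    linarith [Real.exp_le_one_iff.2 (neg_nonpos.2 hk.le)]
  have hq1 : 1 - Real.exp (-k) < 1 := by linarith [Real.exp_pos (-k)]
  obtain ⟨M, hM⟩ := exists_pow_lt_of_lt_one (sub_pos.2 hδ1) hq1
  obtain ⟨N, hN⟩ := exists_nat_gt (M / ε)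
  refine ⟨N, fun c hc δ' hδ' hprod => ?_⟩
  have hMc : M / ε < c := hN.trans_le (by exact_mod_cast hc)
  have hc0 : (0 : ℝ) < c := lt_of_le_of_lt (by positivity) hMc
  have h_bad : (Finset.univ.filter fun i => Real.exp (-k) ≤ δ' i).card < M := by
    by_contra! h
    have h₁ := prod_one_sub_le_pow_card_filter δ' (Real.exp (-k))
      fun i => ⟨(hδ' i).1.le, (hδ' i).2.le⟩
    have h₂ := pow_le_pow_of_le_one hq0 hq1.le h
    linarith
  have h_good : ({i : Fin c | k < Real.log (1 / δ' i)} : Set (Fin c)) =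
      ↑(Finset.univ.filter fun i => ¬ Real.exp (-k) ≤ δ' i) := by
    ext i
    simp only [Set.mem_ofPred_eq, Finset.coe_filter, Finset.mem_univ, true_and, not_le]
    rw [one_div, Real.log_inv, lt_neg, Real.log_lt_iff_lt_exp (hδ' i).1]
  have h_card := Finset.card_filter_add_card_filter_not (s := (Finset.univ : Finset (Fin c)))
    (fun i => Real.exp (-k) ≤ δ' i)
  rw [Finset.card_univ, Fintype.card_fin] at h_card
  rw [h_good, Set.ncard_coe_finset, le_div_iff₀ hc0]
  rw [div_lt_iff₀ hε] at hMc
  have h_bad' : ((Finset.univ.filter fun i => Real.exp (-k) ≤ δ' i).card : ℝ) < M := by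
    exact_mod_cast h_bad
  have h_card' := congrArg (Nat.cast : ℕ → ℝ) h_card
  push_cast at h_card'
  linarith
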